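/- Let p > 0 and β > −1. Then the function U_{β,1}^[p] is integrable on ℝ² and its Fourier transform satisfies Û_{β,1}^[p](x) = p · Γ(1/p)² · ∫₀¹ J₀^[p](2π r x) r (1 − r^p)^β dr for every x ∈ ℝ². -/

import Mathlib

open Real MeasureTheory

/-- The `p`-norm of a point of `ℝ²`. -/
noncomputable def pnorm (p : ℝ) (x : ℝ × ℝ) : ℝ := (|x.1| ^ p + |x.2| ^ p) ^ (1 / p)

/-- The generalized Bessel function of order zero `J₀^[p]`. -/
noncomputable def Jzero (p : ℝ) (η : ℝ × ℝ) : ℝ :=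
  (1 / Real.Gamma (1 / p) ^ 2) * (2 / p) ^ 2 *
    ∫ t in (0:ℝ)..1,
      Real.cos (η.1 * t ^ (1 / p)) * Real.cos (η.2 * (1 - t) ^ (1 / p)) *
        t ^ (1 / p - 1) * (1 - t) ^ (1 / p - 1)

/-- The generalized Bessel function of positive order `J_ω^[p]`. -/
noncomputable def Jord (p ω : ℝ) (η : ℝ × ℝ) : ℝ :=
  pnorm p η ^ ω / (p ^ (ω - 1) * Real.Gamma ω) *
    ∫ τ in (0:ℝ)..1, Jzero p (τ * η.1, τ * η.2) * τ * (1 - τ ^ p) ^ (ω - 1)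

/-- `e^{2πiθ}`. -/
noncomputable def e2πi (θ : ℝ) : ℂ := Complex.exp (((2 * Real.pi * θ : ℝ) : ℂ) * Complex.I)

/-- The integral version `𝒟_β^[p](s : x)`. -/
noncomputable def Dcal (p β s : ℝ) (x : ℝ × ℝ) : ℂ :=
  ((1 / Real.Gamma (β + 1) : ℝ) : ℂ) *
    ∫ ξ in {ξ : ℝ × ℝ | pnorm p ξ ^ p < s},
      (((s - pnorm p ξ ^ p) ^ β : ℝ) : ℂ) * e2πi (x.1 * ξ.1 + x.2 * ξ.2)

/-- The lattice sum version `D_β^[p](s : x)`. -/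
noncomputable def Dlat (p β s : ℝ) (x : ℝ × ℝ) : ℂ :=
  ((1 / Real.Gamma (β + 1) : ℝ) : ℂ) *
    ∑' m : ℤ × ℤ,
      if pnorm p ((m.1 : ℝ), (m.2 : ℝ)) ^ p < s then
        (((s - pnorm p ((m.1 : ℝ), (m.2 : ℝ)) ^ p) ^ β : ℝ) : ℂ) *
          e2πi (x.1 * (m.1 : ℝ) + x.2 * (m.2 : ℝ))
      else 0

/-- The function `U_{β,a}^[p]`. -/
noncomputable def U (p β a : ℝ) (x : ℝ × ℝ) : ℝ :=
  if pnorm p x < a then (a ^ p - pnorm p x ^ p) ^ β else 0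

theorem integrableOn_rpow_mul_one_sub_rpow {a b : ℝ} (ha : 0 < a) (hb : 0 < b) :
    IntegrableOn (fun t : ℝ => t ^ (a - 1) * (1 - t) ^ (b - 1)) (Set.Ioo 0 1) := by
  have h := Complex.betaIntegral_convergent (u := a) (v := b) (by simpa) (by simpa)
  rw [intervalIntegrable_iff_integrableOn_Ioo_of_le zero_le_one] at h
  have h' : IntegrableOn _ _ _ := h.norm
  refine h'.congr_fun (fun t ht => ?_) measurableSet_Ioo
  have h1 : 0 < 1 - t := sub_pos.2 ht.2
  have e : (1 - (t : ℂ)) = ((1 - t : ℝ) : ℂ) := by push_cast; rfl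
  simp only [norm_mul, e]
  rw [Complex.norm_cpow_eq_rpow_re_of_pos ht.1, Complex.norm_cpow_eq_rpow_re_of_pos h1]
  simp

theorem integrableOn_mul_one_sub_rpow_rpow {p β : ℝ} (hp : 0 < p) (hβ : -1 < β) :
    IntegrableOn (fun r : ℝ => r * (1 - r ^ p) ^ β) (Set.Ioo 0 1) := by
  have h := integrableOn_rpow_mul_one_sub_rpow (a := 2 / p) (b := β + 1)
    (by positivity) (by linarith)
  have h2 := (integrable_indicator_iff measurableSet_Ioo).2 h
  have h3 := (integrableOn_Ioi_comp_rpow_iff _ hp.ne').2 (h2.integrableOn (s := Set.Ioi 0))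
  have h4 := (h3.mono_set (Set.Ioo_subset_Ioi_self (a := (1:ℝ)) (b := 0))).const_mul (1 / p)
  refine IntegrableOn.congr_fun h4 (fun r hr => ?_) measurableSet_Ioo
  have hr0 : 0 < r := hr.1
  have hm : r ^ p ∈ Set.Ioo (0 : ℝ) 1 := ⟨rpow_pos_of_pos hr0 p, rpow_lt_one hr0.le hr.2 hp⟩
  have e : r ^ (p - 1) * (r ^ p) ^ (2 / p - 1) = r := by
    rw [← rpow_mul hr0.le, ← rpow_add hr0]
    have : p - 1 + p * (2 / p - 1) = 1 := by field_simp; ring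
    rw [this, rpow_one]
  simp only [Set.indicator_of_mem hm, abs_of_pos hp, smul_eq_mul, add_sub_cancel_right]
  calc _ = (1 / p * p) * (r ^ (p - 1) * (r ^ p) ^ (2 / p - 1)) * (1 - r ^ p) ^ β := by ring
    _ = _ := by rw [e]; field_simp

theorem volume_eq_restrict_Ioi_add_map_neg :
    (volume : Measure ℝ) = volume.restrict (Set.Ioi 0) +
      (volume.restrict (Set.Ioi 0)).map (fun x : ℝ => -x) := by
  have h : (volume.restrict (Set.Ioi (0:ℝ))).map (fun x : ℝ => -x) =
      volume.restrict (Set.Iic 0) := by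
    have h1 := (MeasurableEquiv.neg ℝ).restrict_map volume (Set.Iio 0)
    have h2 : (MeasurableEquiv.neg ℝ : ℝ → ℝ) ⁻¹' Set.Iio 0 = Set.Ioi 0 := by
      ext x
      simp [MeasurableEquiv.neg]
    rw [h2] at h1
    have h3 : (volume : Measure ℝ).map (MeasurableEquiv.neg ℝ) = volume :=
      Measure.map_neg_eq_self _
    rw [h3] at h1
    rw [restrict_Iio_eq_restrict_Iic.symm, h1]
    rfl
  rw [h, ← Set.compl_Ioi (a := (0 : ℝ)), Measure.restrict_add_restrict_compl measurableSet_Ioi]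

/-- The open first quadrant of `ℝ²`. -/
def quadrant : Set (ℝ × ℝ) := Set.Ioi 0 ×ˢ Set.Ioi 0

theorem volume_eq_sum_map_quadrant :
    (volume : Measure (ℝ × ℝ)) = volume.restrict quadrant +
      (volume.restrict quadrant).map (Prod.map id fun y : ℝ => -y) +
      ((volume.restrict quadrant).map (Prod.map (fun x : ℝ => -x) id) +
      (volume.restrict quadrant).map (Prod.map (fun x : ℝ => -x) fun y : ℝ => -y)) := by
  have hq : (volume : Measure (ℝ × ℝ)).restrict quadrant =
      (volume.restrict (Set.Ioi (0:ℝ))).prod (volume.restrict (Set.Ioi (0:ℝ))) := by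
    rw [Measure.prod_restrict]
    rfl
  have hv : (volume : Measure (ℝ × ℝ)) = (volume : Measure ℝ).prod volume := rfl
  have hid := Measure.map_id (μ := volume.restrict (Set.Ioi (0:ℝ)))
  rw [hq, ← Measure.map_prod_map _ _ measurable_id measurable_neg,
    ← Measure.map_prod_map _ _ measurable_neg measurable_id,
    ← Measure.map_prod_map _ _ measurable_neg measurable_neg, hid]
  conv_lhs => rw [hv, volume_eq_restrict_Ioi_add_map_neg]
  rw [Measure.prod_add, Measure.add_prod, Measure.add_prod]
  abel

theorem measurableEmbedding_reflect {f g : ℝ → ℝ} (hf : f = id ∨ f = fun x => -x)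
    (hg : g = id ∨ g = fun x => -x) : MeasurableEmbedding (Prod.map f g) := by
  have h : ∀ {f : ℝ → ℝ}, (f = id ∨ f = fun x => -x) → MeasurableEmbedding f := by
    rintro f (rfl | rfl)
    · exact MeasurableEmbedding.id
    · exact (MeasurableEquiv.neg ℝ).measurableEmbedding
  exact (h hf).prodMap (h hg)

theorem integrable_iff_quadrant {E : Type*} [NormedAddCommGroup E] (f : ℝ × ℝ → E) :
    Integrable f ↔
      (IntegrableOn f quadrant ∧ IntegrableOn (fun z => f (z.1, -z.2)) quadrant) ∧
      (IntegrableOn (fun z => f (-z.1, z.2)) quadrant ∧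
        IntegrableOn (fun z => f (-z.1, -z.2)) quadrant) := by
  conv_lhs => rw [volume_eq_sum_map_quadrant]
  rw [integrable_add_measure, integrable_add_measure, integrable_add_measure,
    (measurableEmbedding_reflect (.inl rfl) (.inr rfl)).integrable_map_iff,
    (measurableEmbedding_reflect (.inr rfl) (.inl rfl)).integrable_map_iff,
    (measurableEmbedding_reflect (.inr rfl) (.inr rfl)).integrable_map_iff]
  rfl

theorem integral_eq_setIntegral_quadrant {E : Type*} [NormedAddCommGroup E] [NormedSpace ℝ E]
    {f : ℝ × ℝ → E} (hf : Integrable f) :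
    ∫ z, f z = ∫ z in quadrant,
      (f z + f (z.1, -z.2) + (f (-z.1, z.2) + f (-z.1, -z.2))) := by
  obtain ⟨⟨h1, h2⟩, h3, h4⟩ := (integrable_iff_quadrant f).1 hf
  have hf' := hf
  rw [volume_eq_sum_map_quadrant, integrable_add_measure, integrable_add_measure,
    integrable_add_measure] at hf'
  obtain ⟨⟨g1, g2⟩, g3, g4⟩ := hf'
  conv_lhs => rw [volume_eq_sum_map_quadrant]
  rw [integral_add_measure (g1.add_measure g2) (g3.add_measure g4), integral_add_measure g1 g2,
    integral_add_measure g3 g4,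
    (measurableEmbedding_reflect (.inl rfl) (.inr rfl)).integral_map,
    (measurableEmbedding_reflect (.inr rfl) (.inl rfl)).integral_map,
    (measurableEmbedding_reflect (.inr rfl) (.inr rfl)).integral_map]
  exact (((integral_add (h1.add h2) (h3.add h4)).trans
    (congrArg₂ (· + ·) (integral_add h1 h2) (integral_add h3 h4)))).symm

/-- Polar-type coordinates `(r, t) ↦ (r t^(1/p), r (1 - t)^(1/p))` adapted to the `p`-norm. -/
noncomputable def polarP (p : ℝ) (z : ℝ × ℝ) : ℝ × ℝ :=
  (z.1 * z.2 ^ (1 / p), z.1 * (1 - z.2) ^ (1 / p))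

/-- The derivative of `polarP`, see `hasFDerivAt_polarP`. -/
noncomputable def fderivPolarP (p : ℝ) (z : ℝ × ℝ) : ℝ × ℝ →L[ℝ] ℝ × ℝ :=
  (Matrix.toLin (.finTwoProd ℝ) (.finTwoProd ℝ)
    !![z.2 ^ (1 / p), z.1 * (1 / p * z.2 ^ (1 / p - 1));
      (1 - z.2) ^ (1 / p), -(z.1 * (1 / p * (1 - z.2) ^ (1 / p - 1)))]).toContinuousLinearMap

/-- The open unit square `(0,1)²`. -/
def openSquare : Set (ℝ × ℝ) := Set.Ioo 0 1 ×ˢ Set.Ioo 0 1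

theorem measurableSet_openSquare : MeasurableSet openSquare :=
  measurableSet_Ioo.prod measurableSet_Ioo

theorem hasFDerivAt_polarP (p : ℝ) {z : ℝ × ℝ} (hz : z ∈ openSquare) :
    HasFDerivAt (polarP p) (fderivPolarP p z) z := by
  unfold fderivPolarP
  rw [Matrix.toLin_finTwoProd_toContinuousLinearMap]
  have h2 : z.2 ≠ 0 := hz.2.1.ne'
  have h3 : 1 - z.2 ≠ 0 := (sub_pos.2 hz.2.2).ne'
  convert! HasFDerivAt.prodMk (𝕜 := ℝ)
    (hasFDerivAt_fst.mul (HasFDerivAt.rpow_const (p := 1 / p) hasFDerivAt_snd (.inl h2)))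
    (hasFDerivAt_fst.mul (HasFDerivAt.rpow_const (p := 1 / p)
      (hasFDerivAt_snd.const_sub (1 : ℝ)) (.inl h3))) using 2 <;>
  · ext <;> simp

theorem abs_det_fderivPolarP {p : ℝ} (hp : 0 < p) {z : ℝ × ℝ} (hz : z ∈ openSquare) :
    |(fderivPolarP p z).det| =
      z.1 * (1 / p) * (z.2 ^ (1 / p - 1) * (1 - z.2) ^ (1 / p - 1)) := by
  have h1 : 0 < z.1 := hz.1.1
  have h2 : 0 < z.2 := hz.2.1
  have h3 : 0 < 1 - z.2 := sub_pos.2 hz.2.2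
  have e2 : z.2 ^ (1 / p) = z.2 * z.2 ^ (1 / p - 1) := by
    rw [rpow_sub_one h2.ne']; field_simp
  have e3 : (1 - z.2) ^ (1 / p) = (1 - z.2) * (1 - z.2) ^ (1 / p - 1) := by
    rw [rpow_sub_one h3.ne']; field_simp
  have h : (fderivPolarP p z).det =
      -(z.1 * (1 / p) * (z.2 ^ (1 / p - 1) * (1 - z.2) ^ (1 / p - 1))) := by
    unfold fderivPolarP
    simp only [LinearMap.det_toContinuousLinearMap, LinearMap.det_toLin, Matrix.det_fin_two_of]
    rw [e2, e3]
    ring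
  rw [h, abs_neg, abs_of_nonneg (by positivity)]

theorem mul_rpow_one_div_rpow {p r t : ℝ} (hp : 0 < p) (hr : 0 ≤ r) (ht : 0 ≤ t) :
    (r * t ^ (1 / p)) ^ p = r ^ p * t := by
  rw [mul_rpow hr (by positivity), ← rpow_mul ht, one_div_mul_cancel hp.ne', rpow_one]

theorem injOn_polarP {p : ℝ} (hp : 0 < p) : Set.InjOn (polarP p) openSquare := by
  rintro ⟨r, t⟩ ⟨⟨hr, -⟩, ht0, ht1⟩ ⟨r', t'⟩ ⟨⟨hr', -⟩, ht0', ht1'⟩ h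
  simp only [polarP, Prod.mk.injEq] at *
  have a := congrArg (· ^ p) h.1
  have b := congrArg (· ^ p) h.2
  simp only [mul_rpow_one_div_rpow hp hr.le ht0.le, mul_rpow_one_div_rpow hp hr'.le ht0'.le,
    mul_rpow_one_div_rpow hp hr.le (sub_pos.2 ht1).le,
    mul_rpow_one_div_rpow hp hr'.le (sub_pos.2 ht1').le] at a b
  have c : r ^ p = r' ^ p := by linarith
  have d : r = r' := (rpow_left_inj hr.le hr'.le hp.ne').1 c
  subst d
  exact ⟨rfl, mul_left_cancel₀ (rpow_pos_of_pos hr p).ne' a⟩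

theorem pnorm_rpow {p : ℝ} (hp : 0 < p) (z : ℝ × ℝ) : pnorm p z ^ p = |z.1| ^ p + |z.2| ^ p := by
  unfold pnorm
  rw [← rpow_mul (by positivity), one_div_mul_cancel hp.ne', rpow_one]

theorem pnorm_polarP {p : ℝ} (hp : 0 < p) {z : ℝ × ℝ} (hz : z ∈ openSquare) :
    pnorm p (polarP p z) = z.1 := by
  have h1 : 0 < z.1 := hz.1.1
  have h2 : 0 < z.2 := hz.2.1
  have h3 : 0 < 1 - z.2 := sub_pos.2 hz.2.2
  unfold pnorm polarP
  simp only
  rw [abs_of_pos (by positivity), abs_of_pos (by positivity),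
    mul_rpow_one_div_rpow hp h1.le h2.le, mul_rpow_one_div_rpow hp h1.le h3.le,
    ← mul_add, add_sub_cancel, mul_one, ← rpow_mul h1.le, mul_one_div_cancel hp.ne', rpow_one]

theorem image_polarP {p : ℝ} (hp : 0 < p) :
    polarP p '' openSquare = quadrant ∩ {z | pnorm p z < 1} := by
  apply Set.Subset.antisymm
  · rintro _ ⟨z, hz, rfl⟩
    refine ⟨⟨?_, ?_⟩, ?_⟩
    · exact mul_pos hz.1.1 (rpow_pos_of_pos hz.2.1 _)
    · exact mul_pos hz.1.1 (rpow_pos_of_pos (sub_pos.2 hz.2.2) _)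
    · change pnorm p (polarP p z) < 1
      rw [pnorm_polarP hp hz]
      exact hz.1.2
  · rintro ⟨u, v⟩ ⟨⟨hu, hv⟩, h⟩
    change 0 < u at hu
    change 0 < v at hv
    change pnorm p (u, v) < 1 at h
    have hup := rpow_pos_of_pos hu p
    have hvp := rpow_pos_of_pos hv p
    have key : ∀ w : ℝ, 0 < w →
        pnorm p (u, v) * (w ^ p / (u ^ p + v ^ p)) ^ (1 / p) = w := by
      intro w hw
      unfold pnorm
      simp only [abs_of_pos hu, abs_of_pos hv]
      rw [← mul_rpow (by positivity) (by positivity), mul_div_cancel₀ _ (by positivity),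
        ← rpow_mul hw.le, mul_one_div_cancel hp.ne', rpow_one]
    refine ⟨(pnorm p (u, v), u ^ p / (u ^ p + v ^ p)), ⟨⟨?_, h⟩, ?_, ?_⟩, ?_⟩
    · unfold pnorm
      simp only [abs_of_pos hu, abs_of_pos hv]
      positivity
    · change 0 < u ^ p / (u ^ p + v ^ p)
      positivity
    · change u ^ p / (u ^ p + v ^ p) < 1
      rw [div_lt_one (by positivity)]
      linarith
    · have e : 1 - u ^ p / (u ^ p + v ^ p) = v ^ p / (u ^ p + v ^ p) := by field_simp; ring
      simp only [polarP, e, key u hu, key v hv]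

theorem U_polarP {p β : ℝ} (hp : 0 < p) {z : ℝ × ℝ} (hz : z ∈ openSquare) :
    U p β 1 (polarP p z) = (1 - z.1 ^ p) ^ β := by
  unfold U
  rw [pnorm_polarP hp hz, if_pos hz.1.2, one_rpow]

theorem measurableSet_quadrant : MeasurableSet quadrant := measurableSet_Ioi.prod measurableSet_Ioi

theorem integrableOn_quadrant_U {p β : ℝ} (hp : 0 < p) (hβ : -1 < β) :
    IntegrableOn (U p β 1) quadrant := by
  have hT : IntegrableOn (U p β 1) (polarP p '' openSquare) := by
    rw [integrableOn_image_iff_integrableOn_abs_det_fderiv_smul volume measurableSet_openSquare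
      (fun z hz => (hasFDerivAt_polarP p hz).hasFDerivWithinAt) (injOn_polarP hp)]
    have h := ((integrableOn_mul_one_sub_rpow_rpow hp hβ).const_mul (1 / p)).mul_prod
      (integrableOn_rpow_mul_one_sub_rpow (a := 1 / p) (b := 1 / p) (by positivity) (by positivity))
    rw [Measure.prod_restrict] at h
    refine IntegrableOn.congr_fun h (fun z hz => ?_) measurableSet_openSquare
    simp only [abs_det_fderivPolarP hp hz, U_polarP hp hz, smul_eq_mul]
    ring
  refine hT.of_forall_sdiff_eq_zero measurableSet_quadrant ?_
  rintro z ⟨hz, hz'⟩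
  rw [image_polarP hp] at hz'
  exact if_neg fun h => hz' ⟨hz, h⟩

theorem U_congr_abs {p β a : ℝ} {z w : ℝ × ℝ} (h1 : |z.1| = |w.1|) (h2 : |z.2| = |w.2|) :
    U p β a z = U p β a w := by
  have h : pnorm p z = pnorm p w := by simp only [pnorm, h1, h2]
  unfold U
  rw [h]

theorem integrable_U {p β : ℝ} (hp : 0 < p) (hβ : -1 < β) : Integrable (U p β 1) := by
  have h := integrableOn_quadrant_U hp hβ
  refine (integrable_iff_quadrant _).2 ⟨⟨h, ?_⟩, ?_, ?_⟩ <;>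
  · convert! h using 2 with z
    exact U_congr_abs (by simp) (by simp)

theorem setIntegral_quadrant_U_mul_cos {p β : ℝ} (hp : 0 < p) (hβ : -1 < β) (a b : ℝ) :
    ∫ z in quadrant, U p β 1 z * (Real.cos (a * z.1) * Real.cos (b * z.2)) =
      1 / p * ∫ r in Set.Ioo (0 : ℝ) 1, (∫ t in Set.Ioo (0 : ℝ) 1,
        Real.cos (r * a * t ^ (1 / p)) * Real.cos (r * b * (1 - t) ^ (1 / p)) *
          t ^ (1 / p - 1) * (1 - t) ^ (1 / p - 1)) * r * (1 - r ^ p) ^ β := by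
  set g : ℝ × ℝ → ℝ := fun z => U p β 1 z * (Real.cos (a * z.1) * Real.cos (b * z.2)) with hg
  have hint : IntegrableOn g quadrant := by
    refine (integrableOn_quadrant_U hp hβ).mul_bdd (c := 1)
      (Continuous.aestronglyMeasurable (by fun_prop)) (.of_forall fun z => ?_)
    rw [norm_mul, ← one_mul (1 : ℝ)]
    exact mul_le_mul (abs_cos_le_one _) (abs_cos_le_one _) (norm_nonneg _) zero_le_one
  have hsub : polarP p '' openSquare ⊆ quadrant := by
    rw [image_polarP hp]
    exact Set.inter_subset_left
  have hzero : ∀ z ∈ quadrant \ polarP p '' openSquare, g z = 0 := by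
    rintro z ⟨hz, hz'⟩
    rw [image_polarP hp] at hz'
    have : U p β 1 z = 0 := if_neg fun h => hz' ⟨hz, h⟩
    simp [hg, this]
  have hder : ∀ z ∈ openSquare, HasFDerivWithinAt (polarP p) (fderivPolarP p z) openSquare z :=
    fun z hz => (hasFDerivAt_polarP p hz).hasFDerivWithinAt
  have heq : ∀ z ∈ openSquare, |(fderivPolarP p z).det| • g (polarP p z) =
      1 / p * ((Real.cos (z.1 * a * z.2 ^ (1 / p)) * Real.cos (z.1 * b * (1 - z.2) ^ (1 / p)) *
        z.2 ^ (1 / p - 1) * (1 - z.2) ^ (1 / p - 1)) * z.1 * (1 - z.1 ^ p) ^ β) := by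
    intro z hz
    simp only [hg, abs_det_fderivPolarP hp hz, U_polarP hp hz, smul_eq_mul]
    simp only [polarP]
    rw [show a * (z.1 * z.2 ^ (1 / p)) = z.1 * a * z.2 ^ (1 / p) by ring,
      show b * (z.1 * (1 - z.2) ^ (1 / p)) = z.1 * b * (1 - z.2) ^ (1 / p) by ring]
    ring
  have hint' := (integrableOn_image_iff_integrableOn_abs_det_fderiv_smul volume
    measurableSet_openSquare hder (injOn_polarP hp) g).1 (hint.mono_set hsub)
  rw [setIntegral_eq_of_subset_of_forall_sdiff_eq_zero measurableSet_quadrant hsub hzero,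
    integral_image_eq_integral_abs_det_fderiv_smul volume measurableSet_openSquare hder
      (injOn_polarP hp), setIntegral_congr_fun measurableSet_openSquare heq]
  replace hint' := hint'.congr_fun heq measurableSet_openSquare
  rw [openSquare, Measure.volume_eq_prod] at *
  rw [setIntegral_prod _ hint', ← integral_const_mul]
  refine integral_congr_ae (.of_forall fun r => ?_)
  simp only [← integral_mul_const, ← integral_const_mul]

theorem continuous_e2πi : Continuous e2πi := by
  unfold e2πi
  fun_prop

theorem norm_e2πi (θ : ℝ) : ‖e2πi θ‖ = 1 := Complex.norm_exp_ofReal_mul_I _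

theorem e2πi_sum_reflect (a b : ℝ) :
    e2πi (-(a + b)) + e2πi (-(a + -b)) + (e2πi (-(-a + b)) + e2πi (-(-a + -b))) =
      ((4 * (Real.cos (2 * π * a) * Real.cos (2 * π * b)) : ℝ) : ℂ) := by
  have h : ∀ s t : ℝ, e2πi (s + t) = e2πi s * e2πi t := by
    intro s t
    simp only [e2πi, ← Complex.exp_add]
    congr 1
    push_cast
    ring
  have hc : ∀ s : ℝ, ((Real.cos (2 * π * s) : ℝ) : ℂ) = (e2πi s + e2πi (-s)) / 2 := by
    intro s
    rw [Complex.ofReal_cos, Complex.cos]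
    simp only [e2πi]
    push_cast
    ring_nf
  rw [Complex.ofReal_mul, Complex.ofReal_mul, hc, hc]
  simp only [neg_add, neg_neg, h]
  push_cast
  ring

/-- `U_{β,1}^[p]` is integrable and its Fourier transform is an integral of `J₀^[p]`. -/
theorem fourier_U_one (p β : ℝ) (hp : 0 < p) (hβ : -1 < β) :
    Integrable (fun x : ℝ × ℝ => U p β 1 x) ∧
      ∀ x : ℝ × ℝ,
        (∫ y : ℝ × ℝ, ((U p β 1 y : ℝ) : ℂ) * e2πi (-(x.1 * y.1 + x.2 * y.2))) =
          (((p * Real.Gamma (1 / p) ^ 2) *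
            ∫ r in (0:ℝ)..1,
              Jzero p (2 * Real.pi * r * x.1, 2 * Real.pi * r * x.2) * r * (1 - r ^ p) ^ β
            : ℝ) : ℂ) := by
  refine ⟨integrable_U hp hβ, fun x => ?_⟩
  have hint : Integrable fun y : ℝ × ℝ =>
      ((U p β 1 y : ℝ) : ℂ) * e2πi (-(x.1 * y.1 + x.2 * y.2)) :=
    (integrable_U hp hβ).ofReal.mul_bdd (c := 1)
      (continuous_e2πi.comp (by fun_prop)).aestronglyMeasurable
      (.of_forall fun y => (norm_e2πi _).le)
  have hfold : ∀ y : ℝ × ℝ,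
      ((U p β 1 y : ℝ) : ℂ) * e2πi (-(x.1 * y.1 + x.2 * y.2)) +
        ((U p β 1 (y.1, -y.2) : ℝ) : ℂ) * e2πi (-(x.1 * y.1 + x.2 * -y.2)) +
        (((U p β 1 (-y.1, y.2) : ℝ) : ℂ) * e2πi (-(x.1 * -y.1 + x.2 * y.2)) +
          ((U p β 1 (-y.1, -y.2) : ℝ) : ℂ) * e2πi (-(x.1 * -y.1 + x.2 * -y.2))) =
      ((4 * (U p β 1 y * (Real.cos (2 * π * x.1 * y.1) * Real.cos (2 * π * x.2 * y.2))) : ℝ) :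
        ℂ) := by
    intro y
    have hs := e2πi_sum_reflect (x.1 * y.1) (x.2 * y.2)
    rw [U_congr_abs (z := (y.1, -y.2)) (w := y) (by simp) (by simp),
      U_congr_abs (z := (-y.1, y.2)) (w := y) (by simp) (by simp),
      U_congr_abs (z := (-y.1, -y.2)) (w := y) (by simp) (by simp)]
    simp only [mul_neg, ← mul_add, hs, mul_assoc]
    push_cast
    ring
  rw [integral_eq_setIntegral_quadrant hint]
  simp only [hfold]
  rw [integral_complex_ofReal, integral_const_mul, setIntegral_quadrant_U_mul_cos hp hβ]
  congr 1
  rw [intervalIntegral.integral_of_le zero_le_one, integral_Ioc_eq_integral_Ioo]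
  simp only [Jzero, intervalIntegral.integral_of_le zero_le_one, integral_Ioc_eq_integral_Ioo]
  simp only [← integral_const_mul]
  refine integral_congr_ae (.of_forall fun r => ?_)
  have hΓ : Real.Gamma (1 / p) ≠ 0 := (Real.Gamma_pos_of_pos (by positivity)).ne'
  have e : ∀ s : ℝ, r * (2 * π * s) = 2 * π * r * s := fun s => by ring
  simp only [e, integral_const_mul]
  field_simp
  norm_num
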